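/- There is a positive absolute constant C such that the following holds. For every ψ ∈ Ψ₁ and every s ∈ Ω₂, one has F(s,ψ) ≠ 0 and |F'(s,ψ)/F(s,ψ)| ≤ C·𝓛, where F'(s,ψ) = −Σ_{n≤D⁴} ν(n)ψ(n)(log n)n^{-s} is the derivative of F in s. -/

import Mathlib

open scoped Classical

noncomputable section

/-- The Dirichlet L-function of `χ` (extended to modulus `0` by `0`, a case never used below). -/
def Lfun {N : ℕ} (χ : DirichletCharacter ℂ N) (s : ℂ) : ℂ :=
  if h : N = 0 then 0
  else
    haveI : NeZero N := ⟨h⟩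
    DirichletCharacter.LFunction χ s

/-- A Dirichlet character is *real* if all of its values are real numbers. -/
def IsRealChar {N : ℕ} (χ : DirichletCharacter ℂ N) : Prop :=
  ∀ a : ZMod N, (χ a).im = 0

/-- `𝓛 = log D`. -/
def bigL (D : ℕ) : ℝ := Real.log D

/-- `P = exp (𝓛 ^ 9)`. -/
def bigP (D : ℕ) : ℝ := Real.exp (bigL D ^ 9)

/-- Assumption (A): `L(1, χ) < 𝓛 ^ (-2022)`. -/
def AssumptionA (D : ℕ) (χ : DirichletCharacter ℂ D) : Prop :=
  (Lfun χ 1).re < bigL D ^ (-2022 : ℤ)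

/-- `p ~ P`, i.e. `p` is a prime with `P < p < P * (1 + 𝓛 ^ (-68))`. -/
def SimP (D p : ℕ) : Prop :=
  p.Prime ∧ bigP D < (p : ℝ) ∧ (p : ℝ) < bigP D * (1 + bigL D ^ (-68 : ℤ))

/-- The finite set of primes `p ~ P`. -/
def primesP (D : ℕ) : Finset ℕ :=
  (Finset.range ⌈2 * bigP D⌉₊).filter (SimP D)

/-- `𝒫 = ∑_{p ~ P} p`. -/
def calP (D : ℕ) : ℝ := ∑ p ∈ primesP D, (p : ℝ)

/-- `ν(n) = ∑_{d ∣ n} χ(d)`. -/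
def nuF (D : ℕ) (χ : DirichletCharacter ℂ D) (n : ℕ) : ℂ :=
  ∑ d ∈ n.divisors, χ (d : ZMod D)

/-- `υ(n) = ∑_{ab = n} μ(a) μ(b) χ(b)`. -/
def upsF (D : ℕ) (χ : DirichletCharacter ℂ D) (n : ℕ) : ℂ :=
  ∑ d ∈ n.divisors,
    ((ArithmeticFunction.moebius (n / d) : ℤ) : ℂ) * ((ArithmeticFunction.moebius d : ℤ) : ℂ) *
      χ (d : ZMod D)

/-- `t₀ = 𝓛 ^ 519`. -/
def t0 (D : ℕ) : ℝ := bigL D ^ 519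

/-- `s₀ = 1/2 + 2 π i t₀`. -/
def s0 (D : ℕ) : ℂ := 1 / 2 + 2 * (Real.pi : ℂ) * Complex.I * (t0 D : ℂ)

/-- `𝓛₁ = 𝓛 ^ 405`. -/
def bigL1 (D : ℕ) : ℝ := bigL D ^ 405

/-- `ν` truncated to `n ≤ D ^ 4`, as an arithmetic function. -/
def nuT (D : ℕ) (χ : DirichletCharacter ℂ D) : ArithmeticFunction ℂ :=
  ⟨fun n => if n = 0 then 0 else if n ≤ D ^ 4 then nuF D χ n else 0, by simp⟩

/-- `υ` truncated to `n ≤ D ^ 4`, as an arithmetic function. -/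
def upsT (D : ℕ) (χ : DirichletCharacter ℂ D) : ArithmeticFunction ℂ :=
  ⟨fun n => if n = 0 then 0 else if n ≤ D ^ 4 then upsF D χ n else 0, by simp⟩

/-- `ν₂₀`, the 20-fold Dirichlet convolution of the truncation of `ν`. -/
def nu20 (D : ℕ) (χ : DirichletCharacter ℂ D) (n : ℕ) : ℂ := (nuT D χ ^ 20) n

/-- `υ₂₀`, the 20-fold Dirichlet convolution of the truncation of `υ`. -/
def ups20 (D : ℕ) (χ : DirichletCharacter ℂ D) (n : ℕ) : ℂ := (upsT D χ ^ 20) n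

/-- `ς(n) = ∑_{lm = n, l ≤ D⁴, m ≤ D⁴} ν(l) υ(m)`. -/
def sigF (D : ℕ) (χ : DirichletCharacter ℂ D) (n : ℕ) : ℂ :=
  ∑ d ∈ n.divisors,
    if d ≤ D ^ 4 ∧ n / d ≤ D ^ 4 then nuF D χ d * upsF D χ (n / d) else 0

/-- `X₁(x, ψ) = ∑_{n ≤ x} ν₂₀(n) ψ(n) n^{-s₀}`. -/
def X1 (D : ℕ) (χ : DirichletCharacter ℂ D) {p : ℕ} (ψ : DirichletCharacter ℂ p) (x : ℝ) : ℂ :=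
  ∑ n ∈ Finset.Icc 1 ⌊x⌋₊, nu20 D χ n * ψ (n : ZMod p) * (n : ℂ) ^ (-s0 D)

/-- `X₂(x, ψ) = ∑_{n ≤ x} υ₂₀(n) ψ(n) n^{-s₀}`. -/
def X2 (D : ℕ) (χ : DirichletCharacter ℂ D) {p : ℕ} (ψ : DirichletCharacter ℂ p) (x : ℝ) : ℂ :=
  ∑ n ∈ Finset.Icc 1 ⌊x⌋₊, ups20 D χ n * ψ (n : ZMod p) * (n : ℂ) ^ (-s0 D)

/-- `X₃(x, ψ) = ∑_{D⁴ < n ≤ x} ν(n) ψ(n) n^{-s₀}`. -/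
def X3 (D : ℕ) (χ : DirichletCharacter ℂ D) {p : ℕ} (ψ : DirichletCharacter ℂ p) (x : ℝ) : ℂ :=
  ∑ n ∈ Finset.Ioc (D ^ 4) ⌊x⌋₊, nuF D χ n * ψ (n : ZMod p) * (n : ℂ) ^ (-s0 D)

/-- `X₄(x, ψ) = ∑_{D⁴ < n ≤ x} ς(n) ψ(n) n^{-s₀}`. -/
def X4 (D : ℕ) (χ : DirichletCharacter ℂ D) {p : ℕ} (ψ : DirichletCharacter ℂ p) (x : ℝ) : ℂ :=
  ∑ n ∈ Finset.Ioc (D ^ 4) ⌊x⌋₊, sigF D χ n * ψ (n : ZMod p) * (n : ℂ) ^ (-s0 D)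

/-- Inequality (3.4). -/
def Ineq1 (D : ℕ) (χ : DirichletCharacter ℂ D) {p : ℕ} (ψ : DirichletCharacter ℂ p) : Prop :=
  ‖X1 D χ ψ ((D : ℝ) ^ 80)‖ + ‖X2 D χ ψ ((D : ℝ) ^ 80)‖ +
      (∫ x in (1 : ℝ)..((D : ℝ) ^ 80), (‖X1 D χ ψ x‖ + ‖X2 D χ ψ x‖) / x) <
    bigL D ^ 1171

/-- Inequality (3.5). -/
def Ineq2 (D : ℕ) (χ : DirichletCharacter ℂ D) {p : ℕ} (ψ : DirichletCharacter ℂ p) : Prop :=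
  ‖X3 D χ ψ (bigP D ^ 2)‖ + (∫ x in ((D : ℝ) ^ 4)..(bigP D ^ 2), ‖X3 D χ ψ x‖ / x) <
    bigL D ^ (-585 : ℤ)

/-- Inequality (3.6). -/
def Ineq3 (D : ℕ) (χ : DirichletCharacter ℂ D) {p : ℕ} (ψ : DirichletCharacter ℂ p) : Prop :=
  ‖X4 D χ ψ ((D : ℝ) ^ 8)‖ + (∫ x in ((D : ℝ) ^ 4)..((D : ℝ) ^ 8), ‖X4 D χ ψ x‖ / x) <
    bigL D ^ (-633 : ℤ)

/-- Membership in `Ψ₁`: `ψ` is a primitive character mod `p` with `p ~ P` satisfying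
(3.4), (3.5) and (3.6). -/
def MemPsi1 (D : ℕ) (χ : DirichletCharacter ℂ D) {p : ℕ} (ψ : DirichletCharacter ℂ p) : Prop :=
  SimP D p ∧ ψ.IsPrimitive ∧ Ineq1 D χ ψ ∧ Ineq2 D χ ψ ∧ Ineq3 D χ ψ

/-- `F(s, ψ) = ∑_{n ≤ D⁴} ν(n) ψ(n) n^{-s}`. -/
def Ffun (D : ℕ) (χ : DirichletCharacter ℂ D) {p : ℕ} (ψ : DirichletCharacter ℂ p) (s : ℂ) : ℂ :=
  ∑ n ∈ Finset.Icc 1 (D ^ 4), nuF D χ n * ψ (n : ZMod p) * (n : ℂ) ^ (-s)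

/-- `G(s, ψ) = ∑_{n ≤ D⁴} υ(n) ψ(n) n^{-s}`. -/
def Gfun (D : ℕ) (χ : DirichletCharacter ℂ D) {p : ℕ} (ψ : DirichletCharacter ℂ p) (s : ℂ) : ℂ :=
  ∑ n ∈ Finset.Icc 1 (D ^ 4), upsF D χ n * ψ (n : ZMod p) * (n : ℂ) ^ (-s)

/-- `F'(s, ψ) = -∑_{n ≤ D⁴} ν(n) ψ(n) (log n) n^{-s}`, the derivative of `F` in `s`. -/
def Ffun' (D : ℕ) (χ : DirichletCharacter ℂ D) {p : ℕ} (ψ : DirichletCharacter ℂ p) (s : ℂ) : ℂ :=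
  -∑ n ∈ Finset.Icc 1 (D ^ 4),
    nuF D χ n * ψ (n : ZMod p) * ((Real.log n : ℝ) : ℂ) * (n : ℂ) ^ (-s)

/-- `F(1 - s, ψ̄) = ∑_{n ≤ D⁴} ν(n) conj(ψ(n)) n^{s - 1}`, as a function of `s`. -/
def FfunBar (D : ℕ) (χ : DirichletCharacter ℂ D) {p : ℕ} (ψ : DirichletCharacter ℂ p)
    (s : ℂ) : ℂ :=
  ∑ n ∈ Finset.Icc 1 (D ^ 4),
    nuF D χ n * (starRingEnd ℂ) (ψ (n : ZMod p)) * (n : ℂ) ^ (s - 1)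

/-- The region `Ω`. -/
def InOmega (D : ℕ) (s : ℂ) : Prop :=
  |(s - s0 D).re| < 1 / 2 ∧ |(s - s0 D).im| < bigL1 D + 2

/-- The region `Ω₁`. -/
def InOmega1 (D : ℕ) (s : ℂ) : Prop :=
  1 / 2 - Real.log (bigL D) / (100 * bigL D) < s.re ∧
    s.re < 1 + Real.log (bigL D) / (100 * bigL D) ∧
    |s.im - 2 * Real.pi * t0 D| < bigL1 D + 5

/-- The region `Ω₂`. -/
def InOmega2 (D : ℕ) (s : ℂ) : Prop :=
  1 / 2 - (bigL D)⁻¹ < s.re ∧ s.re < 1 + (bigL D)⁻¹ ∧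
    |s.im - 2 * Real.pi * t0 D| < bigL1 D + 4

/-- `α = π / log P`. -/
def alphaD (D : ℕ) : ℝ := Real.pi / Real.log (bigP D)

/-- The region `Ω₃`. -/
def InOmega3 (D : ℕ) (s : ℂ) : Prop :=
  1 / 2 - alphaD D < s.re ∧ s.re < 1 + alphaD D ∧
    |s.im - 2 * Real.pi * t0 D| < bigL1 D + 3

/-- The Gauss sum `τ(θ) = ∑_{a mod k} θ(a) e(a/k)`. -/
def tauSum {k : ℕ} (θ : DirichletCharacter ℂ k) : ℂ :=
  ∑ a ∈ Finset.range k,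
    θ (a : ZMod k) * Complex.exp (2 * (Real.pi : ℂ) * Complex.I * (a : ℂ) / (k : ℂ))

/-- The factor `Z(s, θ)` from the functional equation. -/
def Zfun {k : ℕ} (θ : DirichletCharacter ℂ k) (s : ℂ) : ℂ :=
  if θ (-1) = 1 then
    tauSum θ * (Real.pi : ℂ) ^ (s - 1 / 2) * (k : ℂ) ^ (-s) *
      Complex.Gamma ((1 - s) / 2) / Complex.Gamma (s / 2)
  else
    -Complex.I * tauSum θ * (Real.pi : ℂ) ^ (s - 1 / 2) * (k : ℂ) ^ (-s) *
      Complex.Gamma ((2 - s) / 2) / Complex.Gamma ((1 + s) / 2)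

/-- The product character `χψ` modulo `D * p`, i.e. `n ↦ χ(n) ψ(n)`. -/
def chiPsi (D : ℕ) (χ : DirichletCharacter ℂ D) {p : ℕ} (ψ : DirichletCharacter ℂ p) :
    DirichletCharacter ℂ (D * p) :=
  DirichletCharacter.changeLevel (dvd_mul_right D p) χ *
    DirichletCharacter.changeLevel (dvd_mul_left p D) ψ

/-- `Z̃(s, ψ) = Z(s, ψ) Z(s, χψ)`. -/
def Ztilde (D : ℕ) (χ : DirichletCharacter ℂ D) {p : ℕ} (ψ : DirichletCharacter ℂ p)
    (s : ℂ) : ℂ :=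
  Zfun ψ s * Zfun (chiPsi D χ ψ) s

/-- `T = exp (𝓛 ^ 1.1)`. -/
def bigT (D : ℕ) : ℝ := Real.exp (bigL D ^ (1.1 : ℝ))

/-- `P₄ = P T⁻² t₀`. -/
def P4 (D : ℕ) : ℝ := bigP D * bigT D ^ (-2 : ℤ) * t0 D

/-- The smooth weight `g(x) = π^{-1/2} ∫_{-∞}^{𝓛^{15} log x} e^{-u²} du`. -/
def gfun (D : ℕ) (x : ℝ) : ℝ :=
  Real.pi ^ (-(1 : ℝ) / 2) * ∫ u in Set.Iio (bigL D ^ 15 * Real.log x), Real.exp (-u ^ 2)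

/-- `g*(y) = g(y)` for `y > 1/2`, and `0` otherwise. -/
def gstar (D : ℕ) (y : ℝ) : ℝ := if 1 / 2 < y then gfun D y else 0

/-- `K(s, ψ) = ∑_n ψ(n) n^{-s} g*(P₄ / n)`. -/
def Kfun (D : ℕ) {p : ℕ} (ψ : DirichletCharacter ℂ p) (s : ℂ) : ℂ :=
  ∑' n : ℕ, ψ (n : ZMod p) * (n : ℂ) ^ (-s) * ((gstar D (P4 D / n) : ℝ) : ℂ)

/-- `N(1 - s, ψ̄) = ∑_n conj(ψ(n)) n^{s-1} g*(T² / n)`, as a function of `s`. -/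
def Nfun (D : ℕ) {p : ℕ} (ψ : DirichletCharacter ℂ p) (s : ℂ) : ℂ :=
  ∑' n : ℕ,
    (starRingEnd ℂ) (ψ (n : ZMod p)) * (n : ℂ) ^ (s - 1) * ((gstar D (bigT D ^ 2 / n) : ℝ) : ℂ)

/-- `𝔞 = (6/π²) L'(1,χ)² ∏_{q ∣ D} q/(q+1)`. -/
def fraka (D : ℕ) (χ : DirichletCharacter ℂ D) : ℂ :=
  6 / (Real.pi : ℂ) ^ 2 * deriv (Lfun χ) 1 ^ 2 * ∏ q ∈ D.primeFactors, (q : ℂ) / ((q : ℂ) + 1)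

/-- Borel–Carathéodory plus Cauchy for the logarithmic derivative. -/
lemma logDeriv_bound (f : ℂ → ℂ) (z : ℂ) (r M : ℝ) (hr : 0 < r) (hM : 0 < M)
    (hf : DifferentiableOn ℂ f (Metric.ball z r))
    (hlo : ∀ w ∈ Metric.ball z r, Real.exp (-M) ≤ ‖f w‖)
    (hhi : ∀ w ∈ Metric.ball z r, ‖f w‖ ≤ Real.exp M) :
    ‖deriv f z / f z‖ ≤ 8 * M / r := by
  have hne : ∀ w ∈ Metric.ball z r, f w ≠ 0 := by
    intro w hw h0
    have := hlo w hw
    rw [h0, norm_zero] at this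
    exact absurd this (not_le.mpr (Real.exp_pos _))
  have hzm : z ∈ Metric.ball z r := Metric.mem_ball_self hr
  have hd : DifferentiableOn ℂ (fun w => deriv f w / f w) (Metric.ball z r) :=
    (hf.deriv Metric.isOpen_ball).div hf hne
  obtain ⟨g, hgz, hg⟩ := hd.isExactOn_ball.with_val_at z 0
  have hfd : ∀ w ∈ Metric.ball z r, HasDerivAt f (deriv f w) w := fun w hw =>
    (hf.differentiableAt (Metric.isOpen_ball.mem_nhds hw)).hasDerivAt
  have hq : ∀ w ∈ Metric.ball z r, HasDerivAt (fun u => f u * Complex.exp (-g u)) 0 w := by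
    intro w hw
    have h1 := (hfd w hw).mul ((hg w hw).neg.cexp)
    refine h1.congr_deriv ?_
    have := hne w hw
    simp only [Pi.neg_apply]
    field_simp
    ring
  have hconst : ∀ w ∈ Metric.ball z r, f w * Complex.exp (-g w) = f z := by
    intro w hw
    have := (convex_ball z r).is_const_of_fderivWithin_eq_zero (𝕜 := ℂ)
      (f := fun u => f u * Complex.exp (-g u))
      (fun u hu => (hq u hu).differentiableAt.differentiableWithinAt)
      (fun u hu => by
        rw [fderivWithin_of_isOpen Metric.isOpen_ball hu, (hq u hu).hasFDerivAt.fderiv]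
        ext; simp) hw hzm
    simpa [hgz] using this
  have hre : ∀ w ∈ Metric.ball z r, (g w).re ≤ 2 * M := by
    intro w hw
    have h1 := congrArg norm (hconst w hw)
    rw [norm_mul, Complex.norm_exp, Complex.neg_re] at h1
    have h2 : Real.exp (-M) ≤ Real.exp M * Real.exp (-(g w).re) := by
      calc Real.exp (-M) ≤ ‖f z‖ := hlo z hzm
        _ = ‖f w‖ * Real.exp (-(g w).re) := h1.symm
        _ ≤ _ := by gcongr; exact hhi w hw
    rw [← Real.exp_add, Real.exp_le_exp] at h2
    linarith
  have hmap : ∀ u ∈ Metric.ball (0:ℂ) r, z + u ∈ Metric.ball z r := by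
    intro u hu
    simpa using hu
  have hB : ∀ u ∈ Metric.sphere z (r / 2), ‖g u‖ ≤ 4 * M := by
    intro u hu
    have hn : ‖u - z‖ = r / 2 := by simpa [dist_eq_norm] using hu
    have := Complex.borelCaratheodory_zero (f := fun v => g (z + v)) (M := 2 * M) (R := r)
      (z := u - z) (by positivity)
      (by
        intro v hv
        have h1 := (hg (z + v) (hmap v hv)).differentiableAt
        exact (h1.comp v (by fun_prop)).differentiableWithinAt)
      (fun v hv => hre _ (hmap v hv)) hr (by rw [mem_ball_zero_iff, hn]; linarith)
      (by simpa using hgz)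
    rw [hn] at this
    simp only [add_sub_cancel] at this
    calc ‖g u‖ ≤ _ := this
      _ = 4 * M := by field_simp; ring
  have hcb : Metric.closedBall z (r / 2) ⊆ Metric.ball z r :=
    Metric.closedBall_subset_ball (by linarith)
  have hC := Complex.norm_deriv_le_of_forall_mem_sphere_norm_le (f := g) (c := z) (R := r / 2)
    (C := 4 * M) (by positivity)
    (DifferentiableOn.diffContOnCl (by
      rw [closure_ball _ (by positivity)]
      exact fun u hu => (hg u (hcb hu)).differentiableAt.differentiableWithinAt)) hB
  rw [(hg z hzm).deriv] at hC
  calc _ ≤ _ := hC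
    _ = _ := by field_simp; ring

lemma step_integrable (c : ℕ → ℂ) (a b : ℕ) (ha : 1 ≤ a) (hab : a ≤ b) :
    IntervalIntegrable (fun x : ℝ => ‖∑ k ∈ Finset.Icc 0 ⌊x⌋₊, c k‖ / x) MeasureTheory.volume a b := by
  have hab' : (a : ℝ) ≤ b := by exact_mod_cast hab
  have ha' : (1 : ℝ) ≤ a := by exact_mod_cast ha
  rw [intervalIntegrable_iff_integrableOn_Icc_of_le hab']
  have hg : MeasureTheory.IntegrableOn (fun x : ℝ => ((x : ℂ))⁻¹) (Set.Icc (a : ℝ) b) := by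
    apply ContinuousOn.integrableOn_Icc
    apply ContinuousOn.inv₀ (by fun_prop)
    intro x hx
    have : x ≠ 0 := by linarith [hx.1]
    exact_mod_cast this
  have := (integrableOn_mul_sum_Icc c (m := 0) (by positivity) hg).norm
  refine MeasureTheory.IntegrableOn.congr_fun this ?_ measurableSet_Icc
  intro x hx
  have : 0 ≤ x := by linarith [hx.1]
  simp only [norm_mul, norm_inv, Complex.norm_real, Real.norm_eq_abs, abs_of_nonneg this]
  rw [div_eq_inv_mul]

lemma abel_bound (c : ℕ → ℂ) (a b : ℕ) (ha : 1 ≤ a) (hab : a ≤ b) (hc : ∀ n < a, c n = 0)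
    (w : ℂ) (M : ℝ) (hM : ∀ x ∈ Set.Icc (a : ℝ) b, x ^ (-w.re) ≤ M) :
    ‖∑ n ∈ Finset.Icc 0 b, c n * (n : ℂ) ^ (-w)‖ ≤
      M * (‖∑ n ∈ Finset.Icc 0 b, c n‖ +
        ‖w‖ * ∫ x in (a : ℝ)..b, ‖∑ k ∈ Finset.Icc 0 ⌊x⌋₊, c k‖ / x) := by
  have hab' : (a : ℝ) ≤ b := by exact_mod_cast hab
  have ha' : (1 : ℝ) ≤ a := by exact_mod_cast ha
  have hder : ∀ t ∈ Set.Icc (a : ℝ) b,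
      HasDerivAt (fun t : ℝ => (t : ℂ) ^ (-w)) (-w * (t : ℂ) ^ (-w - 1)) t := by
    intro t ht
    have htp : 0 < t := by linarith [ht.1]
    have h1 : HasDerivAt (fun z : ℂ => z ^ (-w)) (-w * (t : ℂ) ^ (-w - 1) * 1) (t : ℂ) :=
      (hasDerivAt_id (t : ℂ)).cpow_const (by simp [Complex.mem_slitPlane_iff, htp])
    rw [mul_one] at h1
    exact h1.comp_ofReal
  have hcont : ContinuousOn (fun t : ℝ => -w * (t : ℂ) ^ (-w - 1)) (Set.Icc (a : ℝ) b) := by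
    apply ContinuousOn.mul continuousOn_const
    apply ContinuousOn.cpow_const (by fun_prop)
    intro t ht
    have htp : 0 < t := by linarith [ht.1]
    simp [Complex.mem_slitPlane_iff, htp]
  have hdi : MeasureTheory.IntegrableOn (deriv (fun t : ℝ => (t : ℂ) ^ (-w)))
      (Set.Icc (a : ℝ) b) :=
    MeasureTheory.IntegrableOn.congr_fun hcont.integrableOn_Icc
      (fun t ht => (hder t ht).deriv.symm) measurableSet_Icc
  have habel := sum_mul_eq_sub_sub_integral_mul' c (f := fun t : ℝ => (t : ℂ) ^ (-w)) hab
    (fun t ht => (hder t ht).differentiableAt) hdi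
  have hsplit : ∑ n ∈ Finset.Icc 0 b, c n * (n : ℂ) ^ (-w) =
      c a * (a : ℂ) ^ (-w) + ∑ n ∈ Finset.Ioc a b, c n * (n : ℂ) ^ (-w) := by
    rw [← Finset.sum_cons (s := Finset.Ioc a b) (f := fun n : ℕ => c n * (n : ℂ) ^ (-w))
      Finset.left_notMem_Ioc, ← Finset.Icc_eq_cons_Ioc hab]
    refine (Finset.sum_subset (Finset.Icc_subset_Icc_left (by omega)) ?_).symm
    intro n hn hn'
    rw [Finset.mem_Icc] at hn hn'
    rw [hc n (by omega), zero_mul]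
  have hSa : ∑ k ∈ Finset.Icc 0 a, c k = c a := by
    refine Finset.sum_eq_single a (fun n hn hna => hc n ?_) (by simp)
    rw [Finset.mem_Icc] at hn; omega
  have heq : ∑ n ∈ Finset.Icc 0 b, c n * (n : ℂ) ^ (-w) =
      (b : ℂ) ^ (-w) * (∑ k ∈ Finset.Icc 0 b, c k) -
        ∫ t in (a : ℝ)..b, (-w * (t : ℂ) ^ (-w - 1)) * ∑ k ∈ Finset.Icc 0 ⌊t⌋₊, c k := by
    rw [hsplit, Finset.sum_congr rfl (fun n _ => mul_comm (c n) _), intervalIntegral.integral_of_le hab']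
    have h2 : ∫ t in Set.Ioc (a : ℝ) b, deriv (fun t : ℝ => (t : ℂ) ^ (-w)) t *
        ∑ k ∈ Finset.Icc 0 ⌊t⌋₊, c k = ∫ t in Set.Ioc (a : ℝ) b, (-w * (t : ℂ) ^ (-w - 1)) *
        ∑ k ∈ Finset.Icc 0 ⌊t⌋₊, c k := by
      apply MeasureTheory.setIntegral_congr_fun measurableSet_Ioc
      intro t ht
      simp only
      rw [(hder t ⟨ht.1.le, ht.2⟩).deriv]
    rw [← h2]
    simp only [Complex.ofReal_natCast] at habel
    rw [habel, hSa]
    ring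
  rw [heq]
  have hb1 : ‖(b : ℂ) ^ (-w)‖ ≤ M := by
    rw [Complex.norm_natCast_cpow_of_pos (by omega), Complex.neg_re]
    exact hM _ ⟨hab', le_rfl⟩
  have hI : ‖∫ t in (a : ℝ)..b, (-w * (t : ℂ) ^ (-w - 1)) * ∑ k ∈ Finset.Icc 0 ⌊t⌋₊, c k‖ ≤
      M * ‖w‖ * ∫ x in (a : ℝ)..b, ‖∑ k ∈ Finset.Icc 0 ⌊x⌋₊, c k‖ / x := by
    rw [← intervalIntegral.integral_const_mul]
    refine intervalIntegral.norm_integral_le_of_norm_le hab' ?_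
      ((step_integrable c a b ha hab).const_mul _)
    refine Filter.Eventually.of_forall fun t ht => ?_
    have htp : 0 < t := by linarith [ht.1]
    rw [norm_mul, norm_mul, norm_neg, Complex.norm_cpow_eq_rpow_re_of_pos htp]
    have h3 : t ^ ((-w - 1).re) ≤ M / t := by
      rw [Complex.sub_re, Complex.neg_re, Complex.one_re, Real.rpow_sub_one htp.ne']
      gcongr
      exact hM _ ⟨ht.1.le, ht.2⟩
    calc _ ≤ ‖w‖ * (M / t) * ‖∑ k ∈ Finset.Icc 0 ⌊t⌋₊, c k‖ := by gcongr
      _ = _ := by ring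
  calc _ ≤ _ := norm_sub_le _ _
    _ ≤ M * ‖∑ k ∈ Finset.Icc 0 b, c k‖ +
        M * ‖w‖ * ∫ x in (a : ℝ)..b, ‖∑ k ∈ Finset.Icc 0 ⌊x⌋₊, c k‖ / x := by
      rw [norm_mul]
      gcongr
    _ = _ := by ring

lemma conv_sum (w : ℕ → ℂ) (hw : ∀ m n, w (m * n) = w m * w n) (f g : ArithmeticFunction ℂ)
    (A B : ℕ) (hf : ∀ n, A < n → f n = 0) (hg : ∀ n, B < n → g n = 0) :
    ∑ n ∈ Finset.Icc 1 (A * B), (f * g) n * w n =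
      (∑ n ∈ Finset.Icc 1 A, f n * w n) * ∑ n ∈ Finset.Icc 1 B, g n * w n := by
  rw [Finset.sum_mul_sum, ← Finset.sum_product']
  rw [← Finset.sum_fiberwise_of_maps_to (s := Finset.Icc 1 A ×ˢ Finset.Icc 1 B)
    (t := Finset.Icc 1 (A * B)) (g := fun x => x.1 * x.2)]
  · refine Finset.sum_congr rfl fun n hn => ?_
    rw [Finset.mem_Icc] at hn
    rw [ArithmeticFunction.mul_apply, Finset.sum_mul]
    symm
    refine Finset.sum_subset_zero_on_sdiff ?_ ?_ ?_
    · intro x hx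
      rw [Finset.mem_filter] at hx
      rw [Nat.mem_divisorsAntidiagonal]
      exact ⟨hx.2, by omega⟩
    · intro x hx
      rw [Finset.mem_sdiff, Nat.mem_divisorsAntidiagonal, Finset.mem_filter, Finset.mem_product,
        Finset.mem_Icc, Finset.mem_Icc] at hx
      obtain ⟨⟨h1, h2⟩, h3⟩ := hx
      have hx1 : x.1 ≠ 0 := by rintro h; simp [h] at h1; omega
      have hx2 : x.2 ≠ 0 := by rintro h; simp [h] at h1; omega
      by_cases hA : A < x.1
      · simp [hf _ hA]
      · by_cases hB : B < x.2
        · simp [hg _ hB]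
        · exact absurd ⟨⟨⟨by omega, by omega⟩, by omega, by omega⟩, h1⟩ h3
    · intro x hx
      rw [Finset.mem_filter] at hx
      rw [← hx.2, hw]
      ring
  · intro x hx
    rw [Finset.mem_product, Finset.mem_Icc, Finset.mem_Icc] at hx
    rw [Finset.mem_Icc]
    exact ⟨Nat.mul_pos hx.1.1 hx.2.1, Nat.mul_le_mul hx.1.2 hx.2.2⟩

lemma conv_supp (f g : ArithmeticFunction ℂ)
    (A B : ℕ) (hf : ∀ n, A < n → f n = 0) (hg : ∀ n, B < n → g n = 0) (n : ℕ) (hn : A * B < n) :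
    (f * g) n = 0 := by
  rw [ArithmeticFunction.mul_apply]
  refine Finset.sum_eq_zero fun x hx => ?_
  rw [Nat.mem_divisorsAntidiagonal] at hx
  by_cases hA : A < x.1
  · simp [hf _ hA]
  · by_cases hB : B < x.2
    · simp [hg _ hB]
    · have := Nat.mul_le_mul (not_lt.mp hA) (not_lt.mp hB)
      omega

lemma pow_sum (w : ℕ → ℂ) (hw : ∀ m n, w (m * n) = w m * w n) (hw1 : w 1 = 1)
    (f : ArithmeticFunction ℂ) (A : ℕ) (hf : ∀ n, A < n → f n = 0) (k : ℕ) :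
    (∀ n, A ^ k < n → (f ^ k) n = 0) ∧
    ∑ n ∈ Finset.Icc 1 (A ^ k), (f ^ k) n * w n = (∑ n ∈ Finset.Icc 1 A, f n * w n) ^ k := by
  induction k with
  | zero =>
    refine ⟨fun n hn => ?_, by simp [hw1]⟩
    rw [pow_zero] at hn ⊢
    exact ArithmeticFunction.one_apply_ne (by omega)
  | succ k ih =>
    refine ⟨fun n hn => ?_, ?_⟩
    · rw [pow_succ] at hn ⊢
      exact conv_supp _ _ _ _ ih.1 hf n hn
    · rw [pow_succ, pow_succ, pow_succ, conv_sum w hw _ _ _ _ ih.1 hf, ih.2]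

lemma nuT_supp (D : ℕ) (χ : DirichletCharacter ℂ D) (n : ℕ) (hn : D ^ 4 < n) : nuT D χ n = 0 := by
  simp [nuT, not_le.mpr hn]

lemma upsT_supp (D : ℕ) (χ : DirichletCharacter ℂ D) (n : ℕ) (hn : D ^ 4 < n) :
    upsT D χ n = 0 := by
  simp [upsT, not_le.mpr hn]

lemma nuT_of (D : ℕ) (χ : DirichletCharacter ℂ D) (n : ℕ) (h0 : n ≠ 0) (hn : n ≤ D ^ 4) :
    nuT D χ n = nuF D χ n := by
  simp [nuT, hn, h0]

lemma upsT_of (D : ℕ) (χ : DirichletCharacter ℂ D) (n : ℕ) (h0 : n ≠ 0) (hn : n ≤ D ^ 4) :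
    upsT D χ n = upsF D χ n := by
  simp [upsT, hn, h0]

lemma sigF_eq (D : ℕ) (χ : DirichletCharacter ℂ D) (n : ℕ) :
    sigF D χ n = (nuT D χ * upsT D χ) n := by
  rw [ArithmeticFunction.mul_apply, Nat.sum_divisorsAntidiagonal (fun a b => nuT D χ a * upsT D χ b),
    sigF]
  refine Finset.sum_congr rfl fun d hd => ?_
  rw [Nat.mem_divisors] at hd
  have hd0 : d ≠ 0 := by rintro rfl; simp at hd
  have hn0 : n / d ≠ 0 := (Nat.div_pos (Nat.le_of_dvd (by omega) hd.1) (by omega)).ne'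
  by_cases h1 : d ≤ D ^ 4
  · by_cases h2 : n / d ≤ D ^ 4
    · rw [if_pos ⟨h1, h2⟩, nuT_of _ _ _ hd0 h1, upsT_of _ _ _ hn0 h2]
    · rw [if_neg (by tauto), upsT_supp _ _ _ (not_le.mp h2), mul_zero]
  · rw [if_neg (by tauto), nuT_supp _ _ _ (not_le.mp h1), zero_mul]

/-- `χ` as an arithmetic function. -/
def chiA (D : ℕ) (χ : DirichletCharacter ℂ D) : ArithmeticFunction ℂ :=
  toArithmeticFunction (fun n : ℕ => χ (n : ZMod D))

/-- `χμ` as an arithmetic function. -/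
def chiMuA (D : ℕ) (χ : DirichletCharacter ℂ D) : ArithmeticFunction ℂ :=
  toArithmeticFunction ((fun n : ℕ => χ (n : ZMod D)) *
    (fun n : ℕ => ((ArithmeticFunction.moebius n : ℤ) : ℂ)))

lemma chiA_mul (D : ℕ) (χ : DirichletCharacter ℂ D) : chiA D χ * chiMuA D χ = 1 := by
  ext n
  have := congrFun (DirichletCharacter.convolution_mul_moebius χ) n
  rw [← ArithmeticFunction.one_eq_delta] at this
  exact this

lemma nuF_eq (D : ℕ) (χ : DirichletCharacter ℂ D) (n : ℕ) :
    nuF D χ n = (((ArithmeticFunction.zeta : ArithmeticFunction ℕ) : ArithmeticFunction ℂ)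
      * chiA D χ) n := by
  rw [ArithmeticFunction.coe_zeta_mul_apply, nuF]
  refine Finset.sum_congr rfl fun d hd => ?_
  have hd0 : d ≠ 0 := (Nat.pos_of_mem_divisors hd).ne'
  simp [chiA, toArithmeticFunction, hd0]

lemma upsF_eq (D : ℕ) (χ : DirichletCharacter ℂ D) (n : ℕ) :
    upsF D χ n = (chiMuA D χ *
      ((ArithmeticFunction.moebius : ArithmeticFunction ℤ) : ArithmeticFunction ℂ)) n := by
  rw [ArithmeticFunction.mul_apply, Nat.sum_divisorsAntidiagonal (fun a b => chiMuA D χ a *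
    ((ArithmeticFunction.moebius : ArithmeticFunction ℤ) : ArithmeticFunction ℂ) b), upsF]
  refine Finset.sum_congr rfl fun d hd => ?_
  have hd0 : d ≠ 0 := (Nat.pos_of_mem_divisors hd).ne'
  simp only [chiMuA, toArithmeticFunction, ArithmeticFunction.coe_mk, hd0, if_false, Pi.mul_apply,
    ArithmeticFunction.intCoe_apply]
  ring

lemma sigF_small (D : ℕ) (χ : DirichletCharacter ℂ D) (n : ℕ) (hz : n ≠ 0) (hn : n ≤ D ^ 4) :
    (nuT D χ * upsT D χ) n = if n = 1 then 1 else 0 := by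
  have h1 : (((ArithmeticFunction.zeta : ArithmeticFunction ℕ) : ArithmeticFunction ℂ) * chiA D χ) *
      (chiMuA D χ * ((ArithmeticFunction.moebius : ArithmeticFunction ℤ) : ArithmeticFunction ℂ))
      = 1 := by
    rw [mul_assoc, ← mul_assoc (chiA D χ), chiA_mul, one_mul,
      ArithmeticFunction.coe_zeta_mul_coe_moebius]
  rw [← ArithmeticFunction.one_apply, ← h1, ArithmeticFunction.mul_apply,
    ArithmeticFunction.mul_apply]
  refine Finset.sum_congr rfl fun x hx => ?_
  rw [Nat.mem_divisorsAntidiagonal] at hx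
  have hx1 : x.1 ≠ 0 := by rintro h; simp [h] at hx; omega
  have hx2 : x.2 ≠ 0 := by rintro h; simp [h] at hx; omega
  rw [← nuF_eq, ← upsF_eq, nuT_of _ _ _ hx1, upsT_of _ _ _ hx2]
  · exact (Nat.le_of_dvd (by omega) ⟨x.1, by rw [← hx.1]; ring⟩).trans hn
  · exact (Nat.le_of_dvd (by omega) ⟨x.2, by rw [← hx.1]⟩).trans hn

/-- the completely multiplicative weight `ψ(n) n^{-s}` -/
def wt {p : ℕ} (ψ : DirichletCharacter ℂ p) (s : ℂ) (n : ℕ) : ℂ :=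
  ψ (n : ZMod p) * (n : ℂ) ^ (-s)

lemma wt_mul {p : ℕ} (ψ : DirichletCharacter ℂ p) (s : ℂ) (m n : ℕ) :
    wt ψ s (m * n) = wt ψ s m * wt ψ s n := by
  simp only [wt, Nat.cast_mul, map_mul, Complex.natCast_mul_natCast_cpow]
  ring

lemma wt_one {p : ℕ} (ψ : DirichletCharacter ℂ p) (s : ℂ) : wt ψ s 1 = 1 := by
  simp [wt]

lemma Ffun_eq (D : ℕ) (χ : DirichletCharacter ℂ D) {p : ℕ} (ψ : DirichletCharacter ℂ p) (s : ℂ) :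
    Ffun D χ ψ s = ∑ n ∈ Finset.Icc 1 (D ^ 4), nuT D χ n * wt ψ s n := by
  refine Finset.sum_congr rfl fun n hn => ?_
  rw [Finset.mem_Icc] at hn
  rw [nuT_of _ _ _ (by omega) hn.2, wt, mul_assoc]

lemma Gfun_eq (D : ℕ) (χ : DirichletCharacter ℂ D) {p : ℕ} (ψ : DirichletCharacter ℂ p) (s : ℂ) :
    Gfun D χ ψ s = ∑ n ∈ Finset.Icc 1 (D ^ 4), upsT D χ n * wt ψ s n := by
  refine Finset.sum_congr rfl fun n hn => ?_
  rw [Finset.mem_Icc] at hn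
  rw [upsT_of _ _ _ (by omega) hn.2, wt, mul_assoc]

lemma wt_split {p : ℕ} (ψ : DirichletCharacter ℂ p) (s s' : ℂ) (n : ℕ) (hn : n ≠ 0) :
    wt ψ s n = ψ (n : ZMod p) * (n : ℂ) ^ (-s') * (n : ℂ) ^ (-(s - s')) := by
  rw [wt, mul_assoc, ← Complex.cpow_add _ _ (by exact_mod_cast hn)]
  congr 2
  ring

lemma sum_Icc_zero (c : ℕ → ℂ) (h : c 0 = 0) (N : ℕ) :
    ∑ n ∈ Finset.Icc 0 N, c n = ∑ n ∈ Finset.Icc 1 N, c n := by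
  refine (Finset.sum_subset (Finset.Icc_subset_Icc_left (by omega)) ?_).symm
  intro n hn hn'
  rw [Finset.mem_Icc] at hn hn'
  rw [show n = 0 by omega, h]

lemma Ffun_deriv (D : ℕ) (χ : DirichletCharacter ℂ D) {p : ℕ} (ψ : DirichletCharacter ℂ p) (s : ℂ) :
    HasDerivAt (Ffun D χ ψ) (Ffun' D χ ψ s) s := by
  unfold Ffun' Ffun
  rw [← Finset.sum_neg_distrib]
  refine HasDerivAt.fun_sum fun n hn => ?_
  rw [Finset.mem_Icc] at hn
  have hn0 : (n : ℂ) ≠ 0 := by exact_mod_cast (by omega : n ≠ 0)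
  have h := ((hasDerivAt_neg s).const_cpow (c := (n : ℂ)) (Or.inl hn0)).const_mul
    (nuF D χ n * ψ (n : ZMod p))
  refine h.congr_deriv ?_
  rw [Complex.natCast_log]
  ring

lemma weight_bound (D : ℕ) (hL : 200 ≤ Real.log (bigL D)) (y : ℝ)
    (hy : -y ≤ Real.log (bigL D) / (100 * bigL D)) (x : ℝ) (hx1 : 1 ≤ x)
    (hx2 : x ≤ (D : ℝ) ^ 80) : x ^ (-y) ≤ bigL D := by
  have hL0 : 0 ≤ bigL D := Real.log_natCast_nonneg D
  have hLp : 0 < bigL D := by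
    rcases hL0.eq_or_lt with h | h
    · rw [← h, Real.log_zero] at hL; linarith
    · exact h
  have hxp : 0 < x := by linarith
  rw [Real.rpow_def_of_pos hxp]
  have h1 : Real.log x ≤ 80 * bigL D := by
    have := Real.log_le_log hxp hx2
    rw [Real.log_pow] at this
    exact_mod_cast this
  have h0 : 0 ≤ Real.log x := Real.log_nonneg hx1
  have h2 : Real.log x * -y ≤ Real.log (bigL D) := by
    calc Real.log x * -y ≤ Real.log x * (Real.log (bigL D) / (100 * bigL D)) := by gcongr
      _ ≤ (80 * bigL D) * (Real.log (bigL D) / (100 * bigL D)) := by gcongr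
      _ = 80 / 100 * Real.log (bigL D) := by field_simp
      _ ≤ _ := by linarith
  calc _ ≤ Real.exp (Real.log (bigL D)) := Real.exp_le_exp.mpr h2
    _ = _ := Real.exp_log hLp

lemma bigL_large (D : ℕ) (hL : 200 ≤ Real.log (bigL D)) : 201 ≤ bigL D := by
  have hL0 : 0 ≤ bigL D := Real.log_natCast_nonneg D
  have hLp : 0 < bigL D := by
    rcases hL0.eq_or_lt with h | h
    · rw [← h, Real.log_zero] at hL; linarith
    · exact h
  have := Real.log_le_sub_one_of_pos hLp
  linarith

lemma D_pos (D : ℕ) (hL : 200 ≤ Real.log (bigL D)) : 1 ≤ D := by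
  rcases Nat.eq_zero_or_pos D with rfl | h
  · have := bigL_large 0 hL
    simp [bigL] at this
    norm_num at this
  · exact h

/-- the partial sums `∑_{n ≤ x} (f^20)(n) ψ(n) n^{-s₀}` -/
def Xgen (D : ℕ) (f : ArithmeticFunction ℂ) {p : ℕ} (ψ : DirichletCharacter ℂ p) (x : ℝ) : ℂ :=
  ∑ n ∈ Finset.Icc 1 ⌊x⌋₊, (f ^ 20) n * ψ (n : ZMod p) * (n : ℂ) ^ (-s0 D)

lemma Xgen_eq (D : ℕ) (f : ArithmeticFunction ℂ) {p : ℕ} (ψ : DirichletCharacter ℂ p) (x : ℝ) :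
    Xgen D f ψ x =
      ∑ n ∈ Finset.Icc 0 ⌊x⌋₊, (f ^ 20) n * ψ (n : ZMod p) * (n : ℂ) ^ (-s0 D) :=
  (sum_Icc_zero _ (by simp only [ArithmeticFunction.map_zero, zero_mul]) _).symm

lemma Xgen_integrable (D : ℕ) (hD : 1 ≤ D) (f : ArithmeticFunction ℂ) {p : ℕ}
    (ψ : DirichletCharacter ℂ p) :
    IntervalIntegrable (fun x : ℝ => ‖Xgen D f ψ x‖ / x) MeasureTheory.volume
      1 ((D : ℝ) ^ 80) := by
  have := step_integrable (fun n => (f ^ 20) n * ψ (n : ZMod p) * (n : ℂ) ^ (-s0 D)) 1 (D ^ 80)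
    le_rfl (Nat.one_le_pow _ _ hD)
  simp only [← Xgen_eq] at this
  exact_mod_cast this

lemma pow20_bound (D : ℕ) (hL : 200 ≤ Real.log (bigL D)) (f : ArithmeticFunction ℂ) {p : ℕ}
    (ψ : DirichletCharacter ℂ p) (hf : ∀ n, D ^ 4 < n → f n = 0) (s : ℂ)
    (hs : -(s - s0 D).re ≤ Real.log (bigL D) / (100 * bigL D)) :
    ‖∑ n ∈ Finset.Icc 1 (D ^ 4), f n * wt ψ s n‖ ^ 20 ≤
      bigL D * (‖Xgen D f ψ ((D : ℝ) ^ 80)‖ +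
        ‖s - s0 D‖ * ∫ x in (1 : ℝ)..((D : ℝ) ^ 80), ‖Xgen D f ψ x‖ / x) := by
  have hD := D_pos D hL
  rw [← norm_pow, ← (pow_sum (wt ψ s) (wt_mul ψ s) (wt_one ψ s) f (D ^ 4) hf 20).2, ← pow_mul]
  have h := abel_bound (fun n => (f ^ 20) n * ψ (n : ZMod p) * (n : ℂ) ^ (-s0 D)) 1 (D ^ 80)
    le_rfl (Nat.one_le_pow _ _ hD)
    (fun n hn => by
      rw [show n = 0 by omega]
      simp only [ArithmeticFunction.map_zero, zero_mul]) (s - s0 D) (bigL D)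
    (fun x hx => by
      push_cast at hx
      exact weight_bound D hL _ hs x hx.1 hx.2)
  have h80 : ⌊(D : ℝ) ^ 80⌋₊ = D ^ 80 := by
    rw [← Nat.cast_pow, Nat.floor_natCast]
  have hX : Xgen D f ψ ((D : ℝ) ^ 80) = ∑ n ∈ Finset.Icc 0 (D ^ 80),
      (f ^ 20) n * ψ (n : ZMod p) * (n : ℂ) ^ (-s0 D) := by rw [Xgen_eq, h80]
  rw [hX]
  simp only [← Xgen_eq] at h
  rw [Nat.cast_pow, Nat.cast_one] at h
  refine le_trans (le_of_eq ?_) h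
  rw [sum_Icc_zero _ (by simp only [ArithmeticFunction.map_zero, zero_mul])]
  congr 1
  refine Finset.sum_congr rfl fun n hn => ?_
  rw [Finset.mem_Icc] at hn
  rw [wt_split ψ s (s0 D) n (by omega)]
  ring

/-- coefficients of `X₄` -/
def c4 (D : ℕ) (χ : DirichletCharacter ℂ D) {p : ℕ} (ψ : DirichletCharacter ℂ p) (n : ℕ) : ℂ :=
  if D ^ 4 < n then sigF D χ n * ψ (n : ZMod p) * (n : ℂ) ^ (-s0 D) else 0

lemma X4_eq (D : ℕ) (χ : DirichletCharacter ℂ D) {p : ℕ} (ψ : DirichletCharacter ℂ p) (x : ℝ) :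
    X4 D χ ψ x = ∑ n ∈ Finset.Icc 0 ⌊x⌋₊, c4 D χ ψ n := by
  unfold X4 c4
  rw [← Finset.sum_filter]
  refine Finset.sum_congr ?_ fun _ _ => rfl
  ext n
  simp only [Finset.mem_Ioc, Finset.mem_filter, Finset.mem_Icc]
  omega

lemma FG_bound (D : ℕ) (hL : 200 ≤ Real.log (bigL D)) (χ : DirichletCharacter ℂ D) {p : ℕ}
    (ψ : DirichletCharacter ℂ p) (s : ℂ)
    (hs : -(s - s0 D).re ≤ Real.log (bigL D) / (100 * bigL D)) :
    ‖Ffun D χ ψ s * Gfun D χ ψ s - 1‖ ≤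
      bigL D * (‖X4 D χ ψ ((D : ℝ) ^ 8)‖ +
        ‖s - s0 D‖ * ∫ x in ((D : ℝ) ^ 4)..((D : ℝ) ^ 8), ‖X4 D χ ψ x‖ / x) := by
  have hD := D_pos D hL
  have hD' : (1 : ℝ) ≤ D := by exact_mod_cast hD
  rw [Ffun_eq, Gfun_eq, ← conv_sum (wt ψ s) (wt_mul ψ s) _ _ _ _ (nuT_supp D χ) (upsT_supp D χ),
    ← pow_add]
  have h := abel_bound (c4 D χ ψ) (D ^ 4) (D ^ 8) (Nat.one_le_pow _ _ hD)
    (Nat.pow_le_pow_right hD (by norm_num))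
    (fun n hn => by rw [c4, if_neg (by omega)]) (s - s0 D) (bigL D)
    (fun x hx => by
      push_cast at hx
      exact weight_bound D hL _ hs x ((one_le_pow₀ hD').trans hx.1)
        (hx.2.trans (pow_le_pow_right₀ hD' (by norm_num))))
  have h8 : ⌊(D : ℝ) ^ 8⌋₊ = D ^ 8 := by
    rw [← Nat.cast_pow, Nat.floor_natCast]
  have hX : X4 D χ ψ ((D : ℝ) ^ 8) = ∑ n ∈ Finset.Icc 0 (D ^ 8), c4 D χ ψ n := by
    rw [X4_eq, h8]
  rw [hX]
  simp only [← X4_eq] at h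
  rw [Nat.cast_pow, Nat.cast_pow] at h
  refine le_trans (le_of_eq ?_) h
  rw [sum_Icc_zero _ (by rw [c4, if_neg (by omega), zero_mul])]
  congr 1
  have hone : (1 : ℂ) = ∑ n ∈ Finset.Icc 1 (D ^ 8), if n = 1 then (1 : ℂ) else 0 := by
    rw [Finset.sum_ite_eq', if_pos]
    rw [Finset.mem_Icc]
    exact ⟨le_rfl, Nat.one_le_pow _ _ hD⟩
  rw [show 4 + 4 = 8 from rfl]
  rw [hone]
  rw [← Finset.sum_sub_distrib]
  refine Finset.sum_congr rfl fun n hn => ?_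
  rw [Finset.mem_Icc] at hn
  by_cases hn4 : D ^ 4 < n
  · have : 1 ≤ D ^ 4 := Nat.one_le_pow _ _ hD
    rw [c4, if_pos hn4, if_neg (by omega), sigF_eq, wt_split ψ s (s0 D) n (by omega)]
    ring
  · rw [c4, if_neg hn4, sigF_small D χ n (by omega) (by omega), zero_mul]
    split_ifs with h1
    · rw [h1, wt_one]; ring
    · ring

lemma pow_le_of_bound (L A I w : ℝ) (hL : 201 ≤ L) (hA : 0 ≤ A) (hI : 0 ≤ I) (B : ℝ)
    (hAI : A + I ≤ B) (hw0 : w ≤ L ^ 406) :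
    L * (A + w * I) ≤ L ^ 407 * B := by
  have h1 : (1 : ℝ) ≤ L ^ 406 := one_le_pow₀ (by linarith)
  calc L * (A + w * I) ≤ L * (L ^ 406 * A + L ^ 406 * I) := by
        gcongr
        nlinarith
    _ = L ^ 407 * (A + I) := by ring
    _ ≤ _ := by gcongr

lemma root_bound (L F : ℝ) (hL : 201 ≤ L) (h : F ^ 20 ≤ L ^ 407 * L ^ 1171) :
    F ≤ L ^ 80 := by
  refine le_of_pow_le_pow_left₀ (n := 20) (by norm_num) (by positivity) (h.trans ?_)
  rw [← pow_add, ← pow_mul]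
  exact pow_le_pow_right₀ (by linarith) (by norm_num)

lemma core_bound (D : ℕ) (hL : 200 ≤ Real.log (bigL D)) (χ : DirichletCharacter ℂ D) {p : ℕ}
    (ψ : DirichletCharacter ℂ p) (hψ : MemPsi1 D χ ψ) (s : ℂ)
    (h1 : 1 / 2 - Real.log (bigL D) / (100 * bigL D) < s.re) (h2 : s.re < 2)
    (h3 : |s.im - 2 * Real.pi * t0 D| < bigL1 D + 5) :
    Real.exp (-(81 * Real.log (bigL D))) ≤ ‖Ffun D χ ψ s‖ ∧
      ‖Ffun D χ ψ s‖ ≤ Real.exp (81 * Real.log (bigL D)) := by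
  obtain ⟨-, -, hI1, -, hI3⟩ := hψ
  have hLL := bigL_large D hL
  have hD := D_pos D hL
  have hD' : (1 : ℝ) ≤ D := by exact_mod_cast hD
  have hLp : 0 < bigL D := by linarith
  have hre : (s - s0 D).re = s.re - 1 / 2 := by
    simp [s0]
  have him : (s - s0 D).im = s.im - 2 * Real.pi * t0 D := by
    simp [s0]
  have hs : -(s - s0 D).re ≤ Real.log (bigL D) / (100 * bigL D) := by
    rw [hre]; linarith
  have hsmall : Real.log (bigL D) / (100 * bigL D) ≤ 1 := by
    rw [div_le_one (by positivity)]
    have := Real.log_le_sub_one_of_pos hLp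
    linarith
  have hw : ‖s - s0 D‖ ≤ bigL D ^ 406 := by
    have ha := Complex.norm_le_abs_re_add_abs_im (s - s0 D)
    rw [him] at ha
    have hb : |(s - s0 D).re| ≤ 2 := by
      rw [hre, abs_le]; constructor <;> linarith
    have hc : (1 : ℝ) ≤ bigL D ^ 405 := one_le_pow₀ (by linarith)
    have hd : bigL D ^ 406 = bigL D * bigL D ^ 405 := by ring
    rw [bigL1] at h3
    rw [hd]
    nlinarith
  unfold Ineq1 at hI1
  unfold Ineq3 at hI3
  have hi1 := Xgen_integrable D hD (nuT D χ) ψ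
  have hi2 := Xgen_integrable D hD (upsT D χ) ψ
  have hD80 : (1 : ℝ) ≤ (D : ℝ) ^ 80 := one_le_pow₀ hD'
  have hsum : (∫ x in (1 : ℝ)..((D : ℝ) ^ 80), (‖X1 D χ ψ x‖ + ‖X2 D χ ψ x‖) / x) =
      (∫ x in (1 : ℝ)..((D : ℝ) ^ 80), ‖Xgen D (nuT D χ) ψ x‖ / x) +
      ∫ x in (1 : ℝ)..((D : ℝ) ^ 80), ‖Xgen D (upsT D χ) ψ x‖ / x := by
    rw [← intervalIntegral.integral_add hi1 hi2]
    simp only [← add_div]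
    rfl
  have hX1 : X1 D χ ψ ((D : ℝ) ^ 80) = Xgen D (nuT D χ) ψ ((D : ℝ) ^ 80) := rfl
  have hX2 : X2 D χ ψ ((D : ℝ) ^ 80) = Xgen D (upsT D χ) ψ ((D : ℝ) ^ 80) := rfl
  rw [hsum, hX1, hX2] at hI1
  have hn1 : 0 ≤ ∫ x in (1 : ℝ)..((D : ℝ) ^ 80), ‖Xgen D (nuT D χ) ψ x‖ / x :=
    intervalIntegral.integral_nonneg hD80 fun x hx => div_nonneg (norm_nonneg _) (by linarith [hx.1])
  have hn2 : 0 ≤ ∫ x in (1 : ℝ)..((D : ℝ) ^ 80), ‖Xgen D (upsT D χ) ψ x‖ / x :=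
    intervalIntegral.integral_nonneg hD80 fun x hx => div_nonneg (norm_nonneg _) (by linarith [hx.1])
  have hn4 : 0 ≤ ∫ x in ((D : ℝ) ^ 4)..((D : ℝ) ^ 8), ‖X4 D χ ψ x‖ / x :=
    intervalIntegral.integral_nonneg (pow_le_pow_right₀ hD' (by norm_num)) fun x hx =>
      div_nonneg (norm_nonneg _) (le_trans (by positivity) hx.1)
  have hm1 := norm_nonneg (Xgen D (nuT D χ) ψ ((D : ℝ) ^ 80))
  have hm2 := norm_nonneg (Xgen D (upsT D χ) ψ ((D : ℝ) ^ 80))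
  have hF : ‖Ffun D χ ψ s‖ ≤ bigL D ^ 80 := by
    refine root_bound _ _ hLL ?_
    rw [Ffun_eq]
    exact (pow20_bound D hL _ ψ (nuT_supp D χ) s hs).trans
      (pow_le_of_bound _ _ _ _ hLL hm1 hn1 _ (by linarith) hw)
  have hG : ‖Gfun D χ ψ s‖ ≤ bigL D ^ 80 := by
    refine root_bound _ _ hLL ?_
    rw [Gfun_eq]
    exact (pow20_bound D hL _ ψ (upsT_supp D χ) s hs).trans
      (pow_le_of_bound _ _ _ _ hLL hm2 hn2 _ (by linarith) hw)
  have hFG : ‖Ffun D χ ψ s * Gfun D χ ψ s - 1‖ ≤ 1 / 2 := by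
    refine ((FG_bound D hL χ ψ s hs).trans
      (pow_le_of_bound _ _ _ _ hLL (norm_nonneg _) hn4 _ hI3.le hw)).trans ?_
    have e1 : bigL D ^ 407 * bigL D ^ (-633 : ℤ) = (bigL D ^ 226)⁻¹ := by
      rw [← zpow_natCast, ← zpow_add₀ hLp.ne', ← zpow_natCast, ← zpow_neg]
      norm_num
    rw [e1, one_div]
    apply inv_anti₀ (by norm_num)
    calc (2 : ℝ) ≤ bigL D := by linarith
      _ ≤ _ := le_self_pow₀ (by linarith) (by norm_num)
  have hFG2 : 1 / 2 ≤ ‖Ffun D χ ψ s‖ * ‖Gfun D χ ψ s‖ := by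
    rw [← norm_mul]
    have := norm_sub_norm_le (1 : ℂ) (Ffun D χ ψ s * Gfun D χ ψ s)
    rw [norm_one, norm_sub_rev] at this
    linarith
  have hexp : Real.exp (81 * Real.log (bigL D)) = bigL D ^ 81 := by
    rw [mul_comm, ← Real.rpow_def_of_pos hLp]
    exact_mod_cast Real.rpow_natCast (bigL D) 81
  have h80 : 0 < bigL D ^ 80 := by positivity
  have h81 : bigL D ^ 81 = bigL D ^ 80 * bigL D := pow_succ _ _
  constructor
  · rw [Real.exp_neg, hexp, inv_le_iff_one_le_mul₀ (by positivity), h81]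
    have : 1 / 2 ≤ ‖Ffun D χ ψ s‖ * bigL D ^ 80 :=
      hFG2.trans (mul_le_mul_of_nonneg_left hG (norm_nonneg _))
    nlinarith
  · rw [hexp, h81]
    nlinarith

/-- For every `ψ ∈ Ψ₁` and every `s ∈ Ω₂`, `F(s,ψ) ≠ 0` and
`|F'(s,ψ)/F(s,ψ)| ≤ C 𝓛`. -/
theorem statement9 :
    ∃ C : ℝ, 0 < C ∧ ∃ D₀ : ℕ, ∀ D : ℕ, D₀ ≤ D → ∀ χ : DirichletCharacter ℂ D,
      IsRealChar χ → χ.IsPrimitive →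
        ∀ (p : ℕ) (ψ : DirichletCharacter ℂ p), MemPsi1 D χ ψ →
          ∀ s : ℂ, InOmega2 D s →
            Ffun D χ ψ s ≠ 0 ∧ ‖Ffun' D χ ψ s / Ffun D χ ψ s‖ ≤ C * bigL D := by
  have hev : ∀ᶠ D : ℕ in Filter.atTop, 200 ≤ Real.log (bigL D) :=
    (Real.tendsto_log_atTop.comp (Real.tendsto_log_atTop.comp
      tendsto_natCast_atTop_atTop)).eventually_ge_atTop 200
  obtain ⟨D₀, hD₀⟩ := Filter.eventually_atTop.mp hev
  refine ⟨129600, by norm_num, D₀, fun D hD χ _ _ p ψ hψ s hs => ?_⟩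
  have hL := hD₀ D hD
  have hLL := bigL_large D hL
  have hLp : 0 < bigL D := by linarith
  obtain ⟨hs1, hs2, hs3⟩ := hs
  have hr : 0 < Real.log (bigL D) / (200 * bigL D) := by positivity
  have hr1 : Real.log (bigL D) / (200 * bigL D) ≤ 1 / 2 := by
    rw [div_le_iff₀ (by positivity)]
    have := Real.log_le_sub_one_of_pos hLp
    linarith
  have hr2 : (bigL D)⁻¹ ≤ Real.log (bigL D) / (200 * bigL D) := by
    rw [inv_eq_one_div, div_le_div_iff₀ hLp (by positivity)]
    nlinarith
  have hr3 : Real.log (bigL D) / (100 * bigL D) = 2 * (Real.log (bigL D) / (200 * bigL D)) := by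
    field_simp
    norm_num
  have hcore : ∀ w ∈ Metric.ball s (Real.log (bigL D) / (200 * bigL D)),
      Real.exp (-(81 * Real.log (bigL D))) ≤ ‖Ffun D χ ψ w‖ ∧
      ‖Ffun D χ ψ w‖ ≤ Real.exp (81 * Real.log (bigL D)) := by
    intro w hw
    rw [Metric.mem_ball, dist_eq_norm] at hw
    have ha := (Complex.abs_re_le_norm (w - s)).trans_lt hw
    have hb := (Complex.abs_im_le_norm (w - s)).trans_lt hw
    rw [Complex.sub_re, abs_lt] at ha
    rw [Complex.sub_im, abs_lt] at hb
    rw [abs_lt] at hs3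
    refine core_bound D hL χ ψ hψ w ?_ ?_ ?_
    · rw [hr3]; linarith [ha.1]
    · linarith [ha.2]
    · rw [abs_lt]; constructor <;> linarith [hb.1, hb.2, hs3.1, hs3.2]
  constructor
  · intro h0
    have := (hcore s (Metric.mem_ball_self hr)).1
    rw [h0, norm_zero] at this
    exact absurd this (not_le.mpr (Real.exp_pos _))
  · have := logDeriv_bound (Ffun D χ ψ) s _ (81 * Real.log (bigL D)) hr (by positivity)
      (fun w _ => (Ffun_deriv D χ ψ w).differentiableAt.differentiableWithinAt)
      (fun w hw => (hcore w hw).1) (fun w hw => (hcore w hw).2)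
    rw [(Ffun_deriv D χ ψ s).deriv] at this
    refine this.trans (le_of_eq ?_)
    have : Real.log (bigL D) ≠ 0 := by linarith
    field_simp
    norm_num

end
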